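/- (Birkhoff–von Neumann.) An n×n real matrix is doubly stochastic if and only if it can be expressed as a convex combination of n×n permutation matrices, i.e., P is doubly stochastic if and only if there exist nonnegative reals α_k, k = 1,…,n!, summing to 1, with P = Σ_{k=1}^{n!} α_k P⁽ᵏ⁾, where P⁽¹⁾,…,P⁽ⁿ!⁾ enumerate the n×n permutation matrices. -/

import Mathlib

open Matrix Nat

/-- An `n × n` real matrix is doubly stochastic if all its entries are
nonnegative, every row sums to 1 and every column sums to 1. -/
def IsDoublyStochastic {n : ℕ} (P : Matrix (Fin n) (Fin n) ℝ) : Prop :=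
  (∀ i j, 0 ≤ P i j) ∧ (∀ i, ∑ j, P i j = 1) ∧ (∀ j, ∑ i, P i j = 1)

/-- A permutation matrix is a doubly stochastic matrix all of whose entries
are 0 or 1. -/
def IsPermutationMatrix {n : ℕ} (P : Matrix (Fin n) (Fin n) ℝ) : Prop :=
  IsDoublyStochastic P ∧ ∀ i j, P i j = 0 ∨ P i j = 1

theorem isDoublyStochastic_iff_mem_doublyStochastic {n : ℕ} {P : Matrix (Fin n) (Fin n) ℝ} :
    IsDoublyStochastic P ↔ P ∈ doublyStochastic ℝ (Fin n) :=
  mem_doublyStochastic_iff_sum.symm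

theorem isPermutationMatrix_permMatrix {n : ℕ} (σ : Equiv.Perm (Fin n)) :
    IsPermutationMatrix (σ.permMatrix ℝ) := by
  refine ⟨isDoublyStochastic_iff_mem_doublyStochastic.2 permMatrix_mem_doublyStochastic,
    fun i j => ?_⟩
  rw [Equiv.Perm.permMatrix, PEquiv.toMatrix_apply]
  split <;> simp

theorem stmt_13 {n : ℕ} (e : Fin (n !) → Matrix (Fin n) (Fin n) ℝ)
    -- e is an enumeration P⁽¹⁾, …, P⁽ⁿ!⁾ of the n × n permutation matrices
    (he_inj : Function.Injective e)
    (he_range : ∀ M : Matrix (Fin n) (Fin n) ℝ,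
      IsPermutationMatrix M ↔ ∃ k, e k = M)
    (P : Matrix (Fin n) (Fin n) ℝ) :
    IsDoublyStochastic P ↔
      ∃ α : Fin (n !) → ℝ, (∀ k, 0 ≤ α k) ∧ ∑ k, α k = 1 ∧
        P = ∑ k, α k • e k := by
  rw [isDoublyStochastic_iff_mem_doublyStochastic]
  constructor
  · intro hP
    obtain ⟨w, hw0, hw1, rfl⟩ := exists_eq_sum_perm_of_mem_doublyStochastic hP
    choose κ hκ using fun σ : Equiv.Perm (Fin n) =>
      (he_range _).1 (isPermutationMatrix_permMatrix σ)
    refine ⟨fun k => ∑ σ with κ σ = k, w σ, fun k => Finset.sum_nonneg fun σ _ => hw0 σ, ?_, ?_⟩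
    · rw [Finset.sum_fiberwise, hw1]
    · rw [← Finset.sum_fiberwise _ κ]
      refine Finset.sum_congr rfl fun k _ => ?_
      rw [Finset.sum_smul]
      refine Finset.sum_congr rfl fun σ hσ => ?_
      rw [← (Finset.mem_filter.1 hσ).2, hκ]
  · rintro ⟨α, hα0, hα1, rfl⟩
    exact convex_doublyStochastic.sum_mem (fun k _ => hα0 k) hα1 fun k _ =>
      isDoublyStochastic_iff_mem_doublyStochastic.1 ((he_range _).2 ⟨k, rfl⟩).1
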